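/- arXiv:2006.16150 — 2 statements merged into one kernel-verified Lean document; each statement's English description precedes it below -/
import Mathlib

section
/- For every n, ex(n, K_3, T_1) = ⌊n/3⌋ and ex(n, K_3, P_4) = ⌊n/3⌋; in other words, in a T_1-free (respectively P_4-free) graph on n vertices there are at most ⌊n/3⌋ triangles, and this is attained. -/
open SimpleGraph Finset Filter

/-- The number of copies of `H` in `G`, i.e. the number of subgraphs of `G`
whose underlying graph is isomorphic to `H`. -/
noncomputable def copyCount {α β : Type*} (H : SimpleGraph α) (G : SimpleGraph β) : ℕ :=
  Nat.card {G' : G.Subgraph // Nonempty (H ≃g G'.coe)}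

/-- `G` is `F`-free: `G` contains no subgraph isomorphic to `F`. -/
def GFree {α β : Type*} (F : SimpleGraph α) (G : SimpleGraph β) : Prop :=
  ¬ ∃ f : α ↪ β, ∀ a b, F.Adj a b → G.Adj (f a) (f b)

/-- The generalized Turán number `ex(n, H, F)`: the maximal number of copies of `H`
in an `F`-free graph on `n` vertices. -/
noncomputable def exN {α β : Type*} (n : ℕ) (H : SimpleGraph α) (F : SimpleGraph β) : ℕ :=
  sSup {m | ∃ G : SimpleGraph (Fin n), GFree F G ∧ copyCount H G = m}

/-- The star `S_r` on `r` vertices: vertex `0` is joined to all other vertices. -/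
def starGraph (r : ℕ) : SimpleGraph (Fin r) :=
  SimpleGraph.fromRel (fun i _ => i.val = 0)

/-- The matching `M_k` with `k` disjoint edges `{2i, 2i+1}`. -/
def matchingGraph (k : ℕ) : SimpleGraph (Fin (2 * k)) :=
  SimpleGraph.fromRel (fun i j => i.val / 2 = j.val / 2)

def friendshipGraph (n : ℕ) : SimpleGraph (Fin n) :=
  SimpleGraph.fromRel (fun i j => i.val = 0 ∨ (i.val + 1) / 2 = (j.val + 1) / 2)

def pawGraph : SimpleGraph (Fin 4) :=
  SimpleGraph.fromRel (fun i j => (i.val ≤ 2 ∧ j.val ≤ 2) ∨ i.val = 0)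

def triangleWithLeaves (l : ℕ) : SimpleGraph (Fin (l + 3)) :=
  SimpleGraph.fromRel (fun i j => (i.val ≤ 2 ∧ j.val ≤ 2) ∨ i.val = 0)

def bookGraph (k : ℕ) : SimpleGraph (Fin (k + 2)) :=
  SimpleGraph.fromRel (fun i _ => i.val ≤ 1)

def triangleFactor (n : ℕ) : SimpleGraph (Fin n) :=
  SimpleGraph.fromRel (fun i j => i.val / 3 = j.val / 3)

def splitGraph (n a : ℕ) : SimpleGraph (Fin n) :=
  SimpleGraph.fromRel (fun i j => i.val < a ∧ ¬ j.val < a)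

def cliquePlusPendant (r : ℕ) : SimpleGraph (Fin (r + 1)) :=
  SimpleGraph.fromRel (fun i j => (i.val < r ∧ j.val < r) ∨ i.val = 0)

/-- A subgraph isomorphic to a complete graph is determined by its vertices. -/
lemma adj_iff_of_top_iso {α V : Type*} {G : SimpleGraph V} {G' : G.Subgraph}
    (e : (⊤ : SimpleGraph α) ≃g G'.coe) {a b : V} :
    G'.Adj a b ↔ a ∈ G'.verts ∧ b ∈ G'.verts ∧ a ≠ b := by
  refine ⟨fun h => ⟨h.fst_mem, h.snd_mem, h.ne⟩, fun ⟨ha, hb, hab⟩ => ?_⟩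
  have h : G'.coe.Adj ⟨a, ha⟩ ⟨b, hb⟩ := by
    rw [← e.symm.map_adj_iff, top_adj]
    simpa using hab
  exact h

/-- Two triangles of a paw-free graph which share a vertex have the same vertices. -/
lemma GFree.verts_subset_of_mem {V : Type*} {G : SimpleGraph V} (hG : GFree pawGraph G)
    {A B : G.Subgraph} (e : (⊤ : SimpleGraph (Fin 3)) ≃g A.coe)
    (e' : (⊤ : SimpleGraph (Fin 3)) ≃g B.coe) {v : V} (hA : v ∈ A.verts) (hB : v ∈ B.verts) :
    B.verts ⊆ A.verts := by
  intro w hw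
  by_contra hwA
  have hvw : G.Adj v w :=
    ((adj_iff_of_top_iso e').2 ⟨hB, hw, fun h => hwA (h ▸ hA)⟩).adj_sub
  let f : Fin 3 → V := fun i => e (Equiv.swap 0 (e.symm ⟨v, hA⟩) i)
  have hf0 : f 0 = v := by simp [f]
  have hf : Function.Injective f :=
    Subtype.val_injective.comp (e.injective.comp (Equiv.injective _))
  have hfA (i) : f i ∈ A.verts := Subtype.coe_prop _
  have hadj {i j} (hij : i ≠ j) : G.Adj (f i) (f j) :=
    ((adj_iff_of_top_iso e).2 ⟨hfA i, hfA j, hf.ne hij⟩).adj_sub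
  have h01 := hadj (i := 0) (j := 1) (by decide)
  have h02 := hadj (i := 0) (j := 2) (by decide)
  have h12 := hadj (i := 1) (j := 2) (by decide)
  have hg : Function.Injective (Fin.snoc f w : Fin 4 → V) :=
    Fin.snoc_injective_iff.2 ⟨hf, fun ⟨i, hi⟩ => hwA (hi ▸ hfA i)⟩
  have hg' : (Fin.snoc f w : Fin 4 → V) = ![f 0, f 1, f 2, w] := by
    funext i
    fin_cases i <;> rfl
  refine hG ⟨⟨_, hg⟩, fun a b hab => ?_⟩
  rw [← hf0] at hvw
  simp only [Function.Embedding.coeFn_mk, hg']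
  fin_cases a <;> fin_cases b <;> simp [pawGraph] at hab <;>
    simp [h01, h02, h12, hvw, h01.symm, h02.symm, h12.symm, hvw.symm]

lemma GFree.three_mul_copyCount_le {V : Type*} [Fintype V] {G : SimpleGraph V}
    (hG : GFree pawGraph G) :
    3 * _root_.copyCount (⊤ : SimpleGraph (Fin 3)) G ≤ Fintype.card V := by
  let e (A : {A : G.Subgraph // Nonempty ((⊤ : SimpleGraph (Fin 3)) ≃g A.coe)}) := A.2.some
  let f : {A : G.Subgraph // Nonempty ((⊤ : SimpleGraph (Fin 3)) ≃g A.coe)} × Fin 3 → V :=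
    fun x => e x.1 x.2
  have hf : Function.Injective f := by
    rintro ⟨A, i⟩ ⟨B, j⟩ h
    have hA : f (A, i) ∈ A.1.verts := Subtype.coe_prop _
    have hB : f (A, i) ∈ B.1.verts := h ▸ Subtype.coe_prop _
    have hv : A.1.verts = B.1.verts :=
      (hG.verts_subset_of_mem (e B) (e A) hB hA).antisymm
        (hG.verts_subset_of_mem (e A) (e B) hA hB)
    obtain rfl : A = B := by
      refine Subtype.ext (Subgraph.ext hv ?_)
      funext a b
      rw [adj_iff_of_top_iso (e A), adj_iff_of_top_iso (e B), hv]
    exact Prod.ext rfl ((e A).injective (Subtype.ext h))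
  simpa [_root_.copyCount, mul_comm] using Nat.card_le_card_of_injective f hf

lemma GFree.of_pathGraph {V : Type*} {G : SimpleGraph V} (hG : GFree (pathGraph 4) G) :
    GFree pawGraph G := by
  rintro ⟨f, hf⟩
  have hp : Function.Injective ![(3 : Fin 4), 0, 1, 2] := by decide
  refine hG ⟨⟨_, f.injective.comp hp⟩, fun a b hab => hf _ _ ?_⟩
  rw [pathGraph_adj] at hab
  fin_cases a <;> fin_cases b <;> simp [pawGraph] at hab ⊢

lemma gFree_pathGraph_triangleFactor (n : ℕ) : GFree (pathGraph 4) (triangleFactor n) := by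
  rintro ⟨f, hf⟩
  have h (a b : Fin 4) (hab : a.val + 1 = b.val) : (f a).val / 3 = (f b).val / 3 := by
    have := (hf a b (pathGraph_adj.2 (.inl hab)))
    simp only [triangleFactor, fromRel_adj] at this
    omega
  have hne (a b : Fin 4) (hab : a ≠ b) : (f a).val ≠ (f b).val :=
    fun h => hab (f.injective (Fin.ext h))
  have := h 0 1 rfl
  have := h 1 2 rfl
  have := h 2 3 rfl
  have := hne 0 1 (by decide)
  have := hne 0 2 (by decide)
  have := hne 0 3 (by decide)
  have := hne 1 2 (by decide)
  have := hne 1 3 (by decide)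
  have := hne 2 3 (by decide)
  omega

lemma le_copyCount_triangleFactor (n : ℕ) :
    n / 3 ≤ _root_.copyCount (⊤ : SimpleGraph (Fin 3)) (triangleFactor n) := by
  let c (k : Fin (n / 3)) : Copy (⊤ : SimpleGraph (Fin 3)) (triangleFactor n) :=
    { toHom :=
        { toFun := fun i => ⟨3 * k + i, by omega⟩
          map_rel' := fun {i j} hij => by
            rw [top_adj] at hij
            simp only [triangleFactor, fromRel_adj, ne_eq, Fin.mk.injEq]
            omega }
      injective' := fun i j hij => by
        have : 3 * k.val + i = 3 * k + j := congrArg Fin.val hij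
        omega }
  let f (k : Fin (n / 3)) :
      {A : (triangleFactor n).Subgraph // Nonempty ((⊤ : SimpleGraph (Fin 3)) ≃g A.coe)} :=
    ⟨(c k).toSubgraph, ⟨(c k).isoToSubgraph⟩⟩
  have hf : Function.Injective f := by
    intro k l hkl
    have hv : (c k).toSubgraph.verts = (c l).toSubgraph.verts :=
      congrArg (fun A => A.1.verts) hkl
    have hk : c k 0 ∈ (c k).toSubgraph.verts := ⟨0, trivial, rfl⟩
    rw [hv] at hk
    obtain ⟨j, -, hj⟩ := hk
    have : 3 * l.val + j = 3 * k + 0 := congrArg Fin.val hj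
    omega
  simpa [_root_.copyCount] using Nat.card_le_card_of_injective f hf

lemma exN_triangle_eq {β : Type*} {F : SimpleGraph β} (n : ℕ)
    (hpaw : ∀ G : SimpleGraph (Fin n), GFree F G → GFree pawGraph G)
    (hfree : GFree F (triangleFactor n)) :
    exN n (⊤ : SimpleGraph (Fin 3)) F = n / 3 := by
  have hle {G : SimpleGraph (Fin n)} (hG : GFree F G) :
      _root_.copyCount (⊤ : SimpleGraph (Fin 3)) G ≤ n / 3 := by
    have := (hpaw G hG).three_mul_copyCount_le
    rw [Fintype.card_fin] at this
    omega
  refine IsGreatest.csSup_eq ⟨⟨triangleFactor n, hfree, ?_⟩, ?_⟩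
  · exact (hle hfree).antisymm (le_copyCount_triangleFactor n)
  · rintro _ ⟨G, hG, rfl⟩
    exact hle hG

/-- `ex(n, K₃, T₁) = ex(n, K₃, P₄) = ⌊n/3⌋`. -/
theorem stmt3 (n : ℕ) :
    exN n (⊤ : SimpleGraph (Fin 3)) pawGraph = n / 3 ∧
    exN n (⊤ : SimpleGraph (Fin 3)) (pathGraph 4) = n / 3 := by
  have h := gFree_pathGraph_triangleFactor n
  exact ⟨exN_triangle_eq n (fun _ => id) h.of_pathGraph,
    exN_triangle_eq n (fun _ hG => hG.of_pathGraph) h⟩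
end

section
/- Let k ≥ 1 and let F be a graph that is not a forest (i.e., F contains a cycle). Then ex(n, M_k, F) = (1+o(1))·ex(n,F)^k / k! as n → ∞; that is, ex(n, M_k, F)·k! / ex(n,F)^k tends to 1 as n → ∞. -/
open SimpleGraph Finset Filter

/-- `G` contains a closed walk of length `m` through `m` distinct vertices. For `3 ≤ m` this is a
cycle of length `m`. -/
def HasCycleOfLength {V : Type*} (G : SimpleGraph V) (m : ℕ) : Prop :=
  ∃ f : ZMod m → V, Function.Injective f ∧ ∀ i, G.Adj (f i) (f (i + 1))

theorem exists_hasCycleOfLength_of_not_isAcyclic {V : Type*} {G : SimpleGraph V}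
    (hG : ¬ G.IsAcyclic) : ∃ m, HasCycleOfLength G (m + 3) := by
  simp only [IsAcyclic, not_forall, not_not] at hG
  obtain ⟨v, c, hc⟩ := hG
  obtain ⟨m, hm⟩ := Nat.exists_eq_add_of_le' hc.three_le_length
  obtain ⟨f⟩ := (cycleGraph_isContained_iff (n := m + 3) (by omega)).2 ⟨v, c, hc, hm⟩
  have hadj : ∀ i : Fin (m + 3), (cycleGraph (m + 3)).Adj i (i + 1) := fun i => by
    rw [cycleGraph_adj]
    right
    rw [add_sub_cancel_left]
  exact ⟨m, fun i => f i, f.injective, fun i => f.toHom.map_adj (hadj i)⟩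

theorem HasCycleOfLength.map {V V' : Type*} {G : SimpleGraph V} {G' : SimpleGraph V'} {m : ℕ}
    (h : HasCycleOfLength G m) (φ : V ↪ V') (hφ : ∀ a b, G.Adj a b → G'.Adj (φ a) (φ b)) :
    HasCycleOfLength G' m := by
  obtain ⟨f, hf, hadj⟩ := h
  exact ⟨φ ∘ f, φ.injective.comp hf, fun i => hφ _ _ (hadj i)⟩

theorem exists_walk_of_forall_adj {V : Type*} {G : SimpleGraph V} (g : ℕ → V) (l : ℕ)
    (h : ∀ t < l, G.Adj (g t) (g (t + 1))) : ∃ p : G.Walk (g 0) (g l), p.length = l := by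
  induction l with
  | zero => exact ⟨.nil, rfl⟩
  | succ l ih =>
    obtain ⟨p, hp⟩ := ih fun t ht => h t (by omega)
    exact ⟨p.concat (h l (by omega)), by simp [hp]⟩

/-- If adding the edge `uv` creates a cycle, then `u` and `v` are joined by a walk whose length is
one less than that of the cycle. -/
theorem HasCycleOfLength.exists_walk_of_sup_edge {V : Type*} {G : SimpleGraph V} {u v : V} {m : ℕ}
    (hG : ¬ HasCycleOfLength G (m + 3)) (h : HasCycleOfLength (G ⊔ edge u v) (m + 3)) :
    ∃ p : G.Walk u v, p.length = m + 2 := by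
  obtain ⟨f, hf, hadj⟩ := h
  have hcast : ∀ t : ℕ, 0 < t → t < m + 3 → (t : ZMod (m + 3)) ≠ 0 := fun t h0 ht h => by
    rw [ZMod.natCast_eq_zero_iff] at h
    exact absurd (Nat.le_of_dvd h0 h) (by omega)
  have hlast : ((m + 2 : ℕ) : ZMod (m + 3)) + 1 = 0 := by
    have := ZMod.natCast_self (m + 3)
    push_cast at this ⊢
    linear_combination this
  have htwo : (2 : ZMod (m + 3)) ≠ 0 := by exact_mod_cast hcast 2 (by omega) (by omega)
  have hj : ∃ j, ¬ G.Adj (f j) (f (j + 1)) := by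
    by_contra! hall
    exact hG ⟨f, hf, hall⟩
  obtain ⟨j, hj⟩ := hj
  have hjuv : (f j = u ∧ f (j + 1) = v) ∨ (f j = v ∧ f (j + 1) = u) := by
    have := hadj j
    rw [sup_adj, edge_adj] at this
    tauto
  have hstep : ∀ i, i ≠ j → G.Adj (f i) (f (i + 1)) := by
    intro i hij
    have hi := hadj i
    rw [sup_adj, edge_adj] at hi
    rcases hi with hi | ⟨hi, -⟩
    · exact hi
    · exfalso
      have aux : (f i = f j ∧ f (i + 1) = f (j + 1)) ∨ (f i = f (j + 1) ∧ f (i + 1) = f j) := by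
        grind
      rcases aux with ⟨h1, -⟩ | ⟨h1, h2⟩
      · exact hij (hf h1)
      · apply htwo
        linear_combination hf h2 - hf h1
  obtain ⟨p, hp⟩ := exists_walk_of_forall_adj (G := G) (fun t : ℕ => f (j + 1 + t)) (m + 2)
    fun t ht => by
      have := hstep (j + 1 + t) fun h => by
        apply hcast (t + 1) (by omega) (by omega)
        push_cast
        linear_combination h
      convert this using 2
      push_cast
      ring
  have h0 : f (j + 1 + ((0 : ℕ) : ZMod (m + 3))) = f (j + 1) := by simp
  have h1 : f (j + 1 + ((m + 2 : ℕ) : ZMod (m + 3))) = f j := by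
    congr 1
    linear_combination hlast
  rcases hjuv with ⟨hu, hv⟩ | ⟨hv, hu⟩
  · exact ⟨(p.copy (h0.trans hv) (h1.trans hu)).reverse, by simpa using hp⟩
  · exact ⟨p.copy (h0.trans hu) (h1.trans hv), by simpa using hp⟩

theorem card_filter_exists_walk_length_le {V : Type*} [Fintype V] (G : SimpleGraph V)
    [DecidableRel G.Adj] {d : ℕ} (hd : ∀ v, G.degree v ≤ d) (l : ℕ) (u : V)
    [DecidablePred fun v => ∃ p : G.Walk u v, p.length = l] :
    #{v | ∃ p : G.Walk u v, p.length = l} ≤ d ^ l := by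
  classical
  induction l generalizing u with
  | zero =>
    rw [pow_zero, card_le_one]
    simp only [mem_filter, mem_univ, true_and]
    rintro a ⟨p, hp⟩ b ⟨q, hq⟩
    rw [← Walk.eq_of_length_eq_zero hp, ← Walk.eq_of_length_eq_zero hq]
  | succ l ih =>
    calc #{v | ∃ p : G.Walk u v, p.length = l + 1}
        ≤ #((G.neighborFinset u).biUnion fun w => {v | ∃ p : G.Walk w v, p.length = l}) := by
          refine card_le_card fun v hv => ?_
          simp only [mem_filter, mem_univ, true_and, mem_biUnion, mem_neighborFinset] at hv ⊢
          obtain ⟨p, hp⟩ := hv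
          cases p with
          | nil => simp at hp
          | cons h q => exact ⟨_, h, q, by simpa using hp⟩
      _ ≤ G.degree u * d ^ l := card_biUnion_le_card_mul _ _ _ fun w _ => ih w
      _ ≤ d ^ (l + 1) := by
          rw [pow_succ']
          exact Nat.mul_le_mul_right _ (hd u)

/-- A greedy construction of graphs with linearly many edges and no cycle of a given length. -/
theorem exists_not_hasCycleOfLength_mul_le_card_edgeFinset (m d n : ℕ)
    (hn : 2 * (d ^ (m + 2) + d + 1) ≤ n) :
    ∃ (G : SimpleGraph (Fin n)) (_ : DecidableRel G.Adj), ¬ HasCycleOfLength G (m + 3) ∧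
      n * d ≤ 4 * #G.edgeFinset := by
  classical
  let P : Finset (SimpleGraph (Fin n)) :=
    {G | ¬ HasCycleOfLength G (m + 3) ∧ ∀ v, G.degree v ≤ d}
  have hP : P.Nonempty := ⟨⊥, by
    simp only [P, mem_filter, mem_univ, true_and]
    exact ⟨fun ⟨f, _, h⟩ => h 0, fun v => by simp⟩⟩
  obtain ⟨G, hGP, hmax⟩ := P.exists_max_image (fun G => #G.edgeFinset) hP
  simp only [P, mem_filter, mem_univ, true_and] at hGP hmax
  obtain ⟨hcyc, hdeg⟩ := hGP
  refine ⟨G, inferInstance, hcyc, ?_⟩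
  let S : Finset (Fin n) := {v | G.degree v < d}
  have hS : #S ≤ d ^ (m + 2) + d + 1 := by
    by_contra! hlt
    obtain ⟨u, hu⟩ : S.Nonempty := card_pos.1 (by omega)
    let T : Finset (Fin n) :=
      univ.filter (fun v => ∃ p : G.Walk u v, p.length = m + 2) ∪ G.neighborFinset u ∪ {u}
    have hT : #T ≤ d ^ (m + 2) + d + 1 := by
      refine (card_union_le _ _).trans ?_
      refine Nat.add_le_add ((card_union_le _ _).trans (Nat.add_le_add ?_ (hdeg u))) (by simp)
      exact card_filter_exists_walk_length_le G hdeg (m + 2) u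
    obtain ⟨v, hvS, hvT⟩ := exists_mem_notMem_of_card_lt_card (hT.trans_lt hlt)
    simp only [T, mem_union, mem_filter, mem_univ, true_and, mem_neighborFinset, mem_singleton,
      not_or] at hvT
    obtain ⟨⟨hwalk, hnadj⟩, hne⟩ := hvT
    have hmem : ∀ w ∈ S, G.degree w < d := fun w hw => by simpa [S] using hw
    have hle := hmax (G ⊔ edge u v) ⟨fun h =>
      hwalk (HasCycleOfLength.exists_walk_of_sup_edge hcyc h), fun w => by
        by_cases hw : w = u ∨ w = v
        · have hwd : G.degree w < d := by rcases hw with rfl | rfl <;> exact hmem _ ‹_›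
          refine le_trans (card_le_card
            (t := insert (if w = u then v else u) (G.neighborFinset w)) ?_)
            ((card_insert_le _ _).trans hwd)
          intro x hx
          simp only [mem_neighborFinset, sup_adj, edge_adj, mem_insert] at hx ⊢
          grind
        · refine le_trans (card_le_card ?_) (hdeg w)
          intro x hx
          simp only [mem_neighborFinset, sup_adj, edge_adj] at hx ⊢
          tauto⟩
    refine absurd hle (not_le_of_gt (Nat.lt_of_succ_le ?_))
    convert! (G.card_edgeFinset_sup_edge hnadj (Ne.symm hne)).ge
  have hsum := G.sum_degrees_eq_twice_card_edges
  have hge : #Sᶜ * d ≤ ∑ v, G.degree v := by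
    calc #Sᶜ * d = ∑ v ∈ Sᶜ, d := by simp
      _ ≤ ∑ v ∈ Sᶜ, G.degree v := sum_le_sum fun v hv => by simpa [S] using hv
      _ ≤ ∑ v, G.degree v := sum_le_univ_sum_of_nonneg fun _ => Nat.zero_le _
  have hcompl : n ≤ 2 * #Sᶜ := by
    rw [card_compl, Fintype.card_fin]
    omega
  nlinarith [Nat.mul_le_mul_right d hcompl]

theorem matchingGraph_adj {k : ℕ} {x y : Fin (2 * k)} :
    (matchingGraph k).Adj x y ↔ x ≠ y ∧ x.val / 2 = y.val / 2 := by
  simp only [matchingGraph, fromRel_adj]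
  grind

/-- The `i`-th edge of the matching graph. -/
def matchingEdge {k : ℕ} (i : Fin k) : Sym2 (Fin (2 * k)) :=
  s(⟨2 * i.val, by omega⟩, ⟨2 * i.val + 1, by omega⟩)

theorem mem_matchingEdge {k : ℕ} {i : Fin k} {x : Fin (2 * k)} :
    x ∈ matchingEdge i ↔ x.val / 2 = i.val := by
  simp only [matchingEdge, Sym2.mem_iff, Fin.ext_iff]
  omega

theorem edgeSet_matchingGraph (k : ℕ) :
    (matchingGraph k).edgeSet = Set.range (matchingEdge (k := k)) := by
  ext e
  induction e with
  | _ x y =>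
    simp only [mem_edgeSet, matchingGraph_adj, Set.mem_range, matchingEdge, Sym2.eq_iff,
      Fin.ext_iff, ne_eq]
    constructor
    · rintro ⟨hne, hdiv⟩
      exact ⟨⟨x.val / 2, by omega⟩, by dsimp only; omega⟩
    · rintro ⟨i, hi⟩
      omega

/-- The sets of `k` pairwise disjoint edges of `G`. -/
noncomputable def matchings {V : Type*} [Fintype V] (G : SimpleGraph V) (k : ℕ) :
    Finset (Finset (Sym2 V)) := by
  classical
  exact {s ∈ G.edgeFinset.powersetCard k |
    ∀ e ∈ s, ∀ e' ∈ s, ∀ v, v ∈ e → v ∈ e' → e = e'}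

theorem mem_matchings {V : Type*} [Fintype V] {G : SimpleGraph V} {k : ℕ} {s : Finset (Sym2 V)} :
    s ∈ matchings G k ↔ ((∀ e ∈ s, e ∈ G.edgeSet) ∧ #s = k) ∧
      ∀ e ∈ s, ∀ e' ∈ s, ∀ v, v ∈ e → v ∈ e' → e = e' := by
  simp [matchings, mem_powersetCard, subset_iff]

theorem edgeSet_toSubgraph_matchingGraph {V : Type*} {G : SimpleGraph V} {k : ℕ}
    (f : Copy (matchingGraph k) G) :
    f.toSubgraph.edgeSet = Set.range fun i => (matchingEdge i).map f := by
  rw [Copy.toSubgraph, Subgraph.edgeSet_map, Subgraph.edgeSet_top, edgeSet_matchingGraph,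
    ← Set.range_comp]
  rfl

theorem toFinset_edgeSet_toSubgraph_mem_matchings {V : Type*} [Fintype V] {G : SimpleGraph V}
    {k : ℕ} (f : Copy (matchingGraph k) G) [Fintype f.toSubgraph.edgeSet] :
    f.toSubgraph.edgeSet.toFinset ∈ matchings G k := by
  classical
  have hdisj : ∀ i j : Fin k, ∀ v, v ∈ (matchingEdge i).map f → v ∈ (matchingEdge j).map f →
      i = j := by
    intro i j v hi hj
    rw [Sym2.mem_map] at hi hj
    obtain ⟨x, hx, rfl⟩ := hi
    obtain ⟨y, hy, hxy⟩ := hj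
    rw [f.injective hxy, mem_matchingEdge] at hy
    rw [mem_matchingEdge] at hx
    exact Fin.ext (hx.symm.trans hy)
  have hinj : Function.Injective fun i : Fin k => (matchingEdge i).map f := by
    intro i j (hij : (matchingEdge i).map f = (matchingEdge j).map f)
    have hmem : f ⟨2 * i.val, by omega⟩ ∈ (matchingEdge i).map f := by simp [matchingEdge]
    exact hdisj i j _ hmem (hij ▸ hmem)
  have heq : f.toSubgraph.edgeSet.toFinset = univ.image fun i => (matchingEdge i).map f := by
    ext e
    rw [Set.mem_toFinset, edgeSet_toSubgraph_matchingGraph]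
    simp
  rw [mem_matchings]
  refine ⟨⟨fun e he => f.toSubgraph.edgeSet_subset (Set.mem_toFinset.1 he), ?_⟩, ?_⟩
  · rw [heq, card_image_of_injective _ hinj, card_univ, Fintype.card_fin]
  · rw [heq]
    simp only [mem_image, mem_univ, true_and]
    rintro _ ⟨i, rfl⟩ _ ⟨j, rfl⟩ v hi hj
    rw [hdisj i j v hi hj]

theorem exists_copy_matchingGraph_of_mem_matchings {V : Type*} [Fintype V] {G : SimpleGraph V}
    {k : ℕ} {s : Finset (Sym2 V)} (hs : s ∈ matchings G k) :
    ∃ f : Copy (matchingGraph k) G, f.toSubgraph.edgeSet = s := by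
  rw [mem_matchings] at hs
  obtain ⟨⟨hsG, hcard⟩, hdisj⟩ := hs
  let e := (s.equivFinOfCardEq hcard).symm
  have hpq : ∀ i : Fin k, ∃ x y, s(x, y) = (e i).val := fun i =>
    Sym2.inductionOn (e i).val fun x y => ⟨x, y, rfl⟩
  choose p q hpq using hpq
  have hadj : ∀ i, G.Adj (p i) (q i) := fun i => by
    rw [← mem_edgeSet, hpq]
    exact hsG _ (e i).2
  let half (x : Fin (2 * k)) : Fin k := ⟨x.val / 2, by omega⟩
  let f (x : Fin (2 * k)) : V := if x.val % 2 = 0 then p (half x) else q (half x)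
  have hmem : ∀ x, f x ∈ (e (half x)).val := fun x => by
    rw [← hpq, Sym2.mem_iff]
    dsimp only [f]
    split_ifs <;> simp
  have hf : Function.Injective f := by
    intro x y hxy
    have hhalf : half x = half y :=
      e.injective (Subtype.ext (hdisj _ (e _).2 _ (e _).2 (f x) (hmem x) (hxy ▸ hmem y)))
    have hdiv : x.val / 2 = y.val / 2 := congrArg Fin.val hhalf
    have hne := (hadj (half y)).ne
    dsimp only [f] at hxy
    rw [hhalf] at hxy
    split_ifs at hxy with h1 h2 h2
    · omega
    · exact absurd hxy hne
    · exact absurd hxy.symm hne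
    · omega
  have hedge : ∀ i, (matchingEdge i).map f = (e i).val := fun i => by
    have h0 : half ⟨2 * i.val, by omega⟩ = i := Fin.ext (by simp [half])
    have h1 : half ⟨2 * i.val + 1, by omega⟩ = i := Fin.ext (by dsimp only [half]; omega)
    rw [← hpq, matchingEdge, Sym2.map_mk]
    simp [f, h0, h1, Nat.add_mod]
  have hhom : ∀ {x y}, (matchingGraph k).Adj x y → G.Adj (f x) (f y) := by
    intro x y hxy
    rw [← mem_edgeSet, edgeSet_matchingGraph] at hxy
    obtain ⟨i, hi⟩ := hxy
    rw [← mem_edgeSet, ← Sym2.map_mk, ← hi, hedge]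
    exact hsG _ (e i).2
  refine ⟨⟨⟨f, hhom⟩, hf⟩, ?_⟩
  rw [edgeSet_toSubgraph_matchingGraph]
  ext x
  constructor
  · rintro ⟨i, rfl⟩
    exact (congrArg (· ∈ (s : Set (Sym2 V))) (hedge i)).mpr (e i).2
  · intro hx
    exact ⟨e.symm ⟨x, hx⟩, (hedge _).trans (by simp)⟩

theorem subgraph_eq_of_edgeSet_eq {V : Type*} {G : SimpleGraph V} {k : ℕ} {G₁ G₂ : G.Subgraph}
    (h₁ : Nonempty (matchingGraph k ≃g G₁.coe)) (h₂ : Nonempty (matchingGraph k ≃g G₂.coe))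
    (h : G₁.edgeSet = G₂.edgeSet) : G₁ = G₂ := by
  have hadj : ∀ x y, G₁.Adj x y ↔ G₂.Adj x y := fun x y => by
    rw [← Subgraph.mem_edgeSet, h, Subgraph.mem_edgeSet]
  have hverts : ∀ G' : G.Subgraph, Nonempty (matchingGraph k ≃g G'.coe) →
      ∀ v, v ∈ G'.verts ↔ ∃ w, G'.Adj v w := by
    rintro G' ⟨e⟩ v
    refine ⟨fun hv => ?_, fun ⟨w, hw⟩ => hw.fst_mem⟩
    have hex : ∃ y, (matchingGraph k).Adj (e.symm ⟨v, hv⟩) y := by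
      generalize e.symm ⟨v, hv⟩ = x
      refine ⟨⟨2 * (x.val / 2) + (1 - x.val % 2), by omega⟩, ?_⟩
      rw [matchingGraph_adj, ne_eq, Fin.ext_iff]
      dsimp only
      omega
    obtain ⟨y, hy⟩ := hex
    have := e.map_adj_iff.2 hy
    rw [e.apply_symm_apply, Subgraph.coe_adj] at this
    exact ⟨_, this⟩
  refine Subgraph.ext (Set.ext fun v => ?_) (by ext x y; exact hadj x y)
  rw [hverts G₁ h₁, hverts G₂ h₂]
  simp only [hadj]

theorem copyCount_matchingGraph {V : Type*} [Fintype V] (G : SimpleGraph V) (k : ℕ) :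
    _root_.copyCount (matchingGraph k) G = #(matchings G k) := by
  classical
  have hcopy : ∀ G' : G.Subgraph, Nonempty (matchingGraph k ≃g G'.coe) ↔
      ∃ f : Copy (matchingGraph k) G, f.toSubgraph = G' := fun G' =>
    (Set.ext_iff.1 (Copy.range_toSubgraph (A := matchingGraph k) (B := G)) G').symm
  have hmem : ∀ G' : G.Subgraph, Nonempty (matchingGraph k ≃g G'.coe) →
      G'.edgeSet.toFinset ∈ matchings G k := by
    intro G' h
    obtain ⟨f, rfl⟩ := (hcopy G').1 h
    exact toFinset_edgeSet_toSubgraph_mem_matchings f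
  rw [_root_.copyCount, ← Nat.card_eq_finsetCard]
  refine Nat.card_eq_of_bijective (fun G' => ⟨G'.1.edgeSet.toFinset, hmem _ G'.2⟩) ⟨?_, ?_⟩
  · rintro ⟨G₁, h₁⟩ ⟨G₂, h₂⟩ h
    exact Subtype.ext (subgraph_eq_of_edgeSet_eq h₁ h₂ (Set.toFinset_inj.1 (Subtype.mk.inj h)))
  · rintro ⟨s, hs⟩
    obtain ⟨f, hf⟩ := exists_copy_matchingGraph_of_mem_matchings hs
    refine ⟨⟨f.toSubgraph, (hcopy _).2 ⟨f, rfl⟩⟩, Subtype.ext ?_⟩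
    simp only [hf, Finset.toFinset_coe]

theorem card_matchings_one {V : Type*} [Fintype V] (G : SimpleGraph V) [Fintype G.edgeSet] :
    #(matchings G 1) = #G.edgeFinset := by
  classical
  have : matchings G 1 = G.edgeFinset.powersetCard 1 := by
    ext s
    rw [mem_matchings, mem_powersetCard]
    simp only [subset_iff, mem_edgeFinset, and_iff_left_iff_imp, and_imp]
    intro _ hs e he e' he' _ _ _
    exact card_le_one.1 hs.le e he e' he'
  rw [this, card_powersetCard, Nat.choose_one_right]

theorem copyCount_top_fin_two {V : Type*} [Fintype V] (G : SimpleGraph V) [Fintype G.edgeSet] :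
    _root_.copyCount (⊤ : SimpleGraph (Fin 2)) G = #G.edgeFinset := by
  have htop : (⊤ : SimpleGraph (Fin (2 * 1))) = matchingGraph 1 := by
    ext x y
    rw [matchingGraph_adj, top_adj, ne_eq, iff_self_and]
    omega
  rw [← card_matchings_one, ← copyCount_matchingGraph, ← htop]

theorem card_matchings_mul_factorial_le {V : Type*} [Fintype V] (G : SimpleGraph V)
    [Fintype G.edgeSet] (k : ℕ) : #(matchings G k) * k.factorial ≤ #G.edgeFinset ^ k := by
  classical
  have hsub : matchings G k ⊆ G.edgeFinset.powersetCard k := fun s hs => by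
    rw [mem_matchings] at hs
    rw [mem_powersetCard]
    exact ⟨fun e he => mem_edgeFinset.2 (hs.1.1 e he), hs.1.2⟩
  calc #(matchings G k) * k.factorial ≤ (#G.edgeFinset).choose k * k.factorial := by
        rw [← card_powersetCard]
        exact Nat.mul_le_mul_right _ (card_le_card hsub)
    _ = (#G.edgeFinset).descFactorial k := by
        rw [Nat.descFactorial_eq_factorial_mul_choose, mul_comm]
    _ ≤ #G.edgeFinset ^ k := Nat.descFactorial_le_pow _ _

/-- Every matching with `k` edges extends in at least `e(G) - 2kn` ways. -/
theorem card_matchings_mul_le {V : Type*} [Fintype V] (G : SimpleGraph V)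
    [Fintype G.edgeSet] (k : ℕ) :
    #(matchings G k) * (#G.edgeFinset - 2 * k * Fintype.card V) ≤
      #(matchings G (k + 1)) * (k + 1) := by
  classical
  refine card_mul_le_card_mul (fun s t => s ⊆ t) (fun s hs => ?_) (fun t ht => ?_)
  · have hs' := hs
    rw [mem_matchings] at hs'
    obtain ⟨⟨hsG, hcard⟩, hdisj⟩ := hs'
    let U : Finset V := s.biUnion Sym2.toFinset
    let B : Finset (Sym2 V) := U.biUnion fun v => G.incidenceFinset v
    have hU : #U ≤ k * 2 := by
      rw [← hcard]
      refine card_biUnion_le_card_mul _ _ _ fun e he => ?_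
      rw [Sym2.card_toFinset]
      split_ifs <;> omega
    have hB : #B ≤ 2 * k * Fintype.card V := by
      calc #B ≤ #U * Fintype.card V := card_biUnion_le_card_mul _ _ _ fun v _ => by
            rw [card_incidenceFinset_eq_degree]
            exact (G.degree_lt_card_verts v).le
        _ ≤ 2 * k * Fintype.card V := Nat.mul_le_mul_right _ (by omega)
    have hfree : ∀ e ∈ G.edgeFinset \ B, e ∈ G.edgeSet ∧ ∀ e' ∈ s, ∀ v, v ∈ e → v ∉ e' := by
      intro e he
      rw [Finset.mem_sdiff, mem_edgeFinset] at he
      refine ⟨he.1, fun e' he' v hv hv' => he.2 ?_⟩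
      simp only [B, U, mem_biUnion, Sym2.mem_toFinset, mem_incidenceFinset]
      exact ⟨v, ⟨e', he', hv'⟩, he.1, hv⟩
    have hnot : ∀ e ∈ G.edgeFinset \ B, e ∉ s := fun e he hes =>
      (hfree e he).2 e hes _ e.out_fst_mem e.out_fst_mem
    calc #G.edgeFinset - 2 * k * Fintype.card V ≤ #(G.edgeFinset \ B) :=
          (Nat.sub_le_sub_left hB _).trans (le_card_sdiff _ _)
      _ = #((G.edgeFinset \ B).image fun e => insert e s) := by
          rw [card_image_of_injOn]
          intro e he e' he' h
          have : e ∈ insert e' s := (congrArg (e ∈ ·) h).mp (mem_insert_self e s)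
          exact (mem_insert.1 this).resolve_right (hnot e he)
      _ ≤ _ := by
          refine card_le_card fun t ht => ?_
          obtain ⟨e, he, rfl⟩ := mem_image.1 ht
          obtain ⟨heG, hdis⟩ := hfree e he
          rw [mem_bipartiteAbove, mem_matchings]
          refine ⟨⟨⟨?_, by rw [card_insert_of_notMem (hnot e he), hcard]⟩, ?_⟩,
            subset_insert _ _⟩
          · simpa [mem_insert, heG] using hsG
          · intro a ha b hb v hva hvb
            rw [mem_insert] at ha hb
            rcases ha with rfl | ha <;> rcases hb with rfl | hb
            · rfl
            · exact absurd hvb (hdis b hb v hva)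
            · exact absurd hva (hdis a ha v hvb)
            · exact hdisj a ha b hb v hva hvb
  · rw [mem_matchings] at ht
    calc _ ≤ #(t.powersetCard k) := by
          refine card_le_card fun s hs => ?_
          rw [mem_bipartiteBelow, mem_matchings] at hs
          exact mem_powersetCard.2 ⟨hs.2, hs.1.1.2⟩
      _ = k + 1 := by rw [card_powersetCard, ht.1.2, Nat.choose_succ_self_right]

theorem pow_le_card_matchings_mul_factorial {V : Type*} [Fintype V] (G : SimpleGraph V)
    [Fintype G.edgeSet] (k : ℕ) :
    (#G.edgeFinset - 2 * k * Fintype.card V) ^ k ≤ #(matchings G k) * k.factorial := by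
  suffices h : ∀ j ≤ k, (#G.edgeFinset - 2 * k * Fintype.card V) ^ j ≤
      #(matchings G j) * j.factorial from h k le_rfl
  intro j
  induction j with
  | zero =>
    intro _
    have : ∅ ∈ matchings G 0 := by simp [mem_matchings]
    simpa using card_pos.2 ⟨_, this⟩
  | succ j ih =>
    intro hj
    have hmono : #G.edgeFinset - 2 * k * Fintype.card V ≤
        #G.edgeFinset - 2 * j * Fintype.card V :=
      Nat.sub_le_sub_left (Nat.mul_le_mul_right _ (by omega)) _
    calc (#G.edgeFinset - 2 * k * Fintype.card V) ^ (j + 1)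
        ≤ #(matchings G j) * j.factorial * (#G.edgeFinset - 2 * j * Fintype.card V) := by
          rw [pow_succ]
          exact Nat.mul_le_mul (ih (by omega)) hmono
      _ = #(matchings G j) * (#G.edgeFinset - 2 * j * Fintype.card V) * j.factorial := by ring
      _ ≤ #(matchings G (j + 1)) * (j + 1) * j.factorial :=
          Nat.mul_le_mul_right _ (card_matchings_mul_le G j)
      _ = #(matchings G (j + 1)) * (j + 1).factorial := by rw [Nat.factorial_succ]; ring

theorem finite_setOf_copyCount {α β : Type*} (n : ℕ) (H : SimpleGraph α) (F : SimpleGraph β) :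
    {m | ∃ G : SimpleGraph (Fin n), GFree F G ∧ _root_.copyCount H G = m}.Finite :=
  (Set.finite_range fun G : SimpleGraph (Fin n) => _root_.copyCount H G).subset
    fun _ ⟨G, _, hG⟩ => ⟨G, hG⟩

theorem copyCount_le_exN {α β : Type*} {n : ℕ} (H : SimpleGraph α) {F : SimpleGraph β}
    {G : SimpleGraph (Fin n)} (hG : GFree F G) : _root_.copyCount H G ≤ exN n H F :=
  le_csSup (finite_setOf_copyCount n H F).bddAbove ⟨G, hG, rfl⟩

theorem exists_copyCount_eq_exN {α β : Type*} (n : ℕ) (H : SimpleGraph α) {F : SimpleGraph β}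
    (hF : F ≠ ⊥) : ∃ G : SimpleGraph (Fin n), GFree F G ∧ _root_.copyCount H G = exN n H F := by
  obtain ⟨a, b, hab⟩ := ne_bot_iff_exists_adj.1 hF
  have hne : {m | ∃ G : SimpleGraph (Fin n), GFree F G ∧ _root_.copyCount H G = m}.Nonempty :=
    ⟨_, ⊥, fun ⟨f, hf⟩ => hf a b hab, rfl⟩
  exact Nat.sSup_mem hne (finite_setOf_copyCount n H F).bddAbove

theorem tendsto_div_exN_top {W : Type*} {F : SimpleGraph W} (hF : ¬ F.IsAcyclic) :
    Tendsto (fun n : ℕ => (n : ℝ) / exN n (⊤ : SimpleGraph (Fin 2)) F) atTop (nhds 0) := by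
  obtain ⟨m, hm⟩ := exists_hasCycleOfLength_of_not_isAcyclic hF
  rw [Metric.tendsto_atTop]
  intro ε hε
  obtain ⟨d, hd⟩ := exists_nat_gt (4 / ε)
  refine ⟨2 * (d ^ (m + 2) + d + 1), fun n hn => ?_⟩
  obtain ⟨G, _, hcyc, hle⟩ := exists_not_hasCycleOfLength_mul_le_card_edgeFinset m d n hn
  have hex : #G.edgeFinset ≤ exN n (⊤ : SimpleGraph (Fin 2)) F := by
    rw [← copyCount_top_fin_two]
    exact copyCount_le_exN _ fun ⟨f, hf⟩ => hcyc (hm.map f hf)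
  have hdpos : (0 : ℝ) < d := (div_pos four_pos hε).trans hd
  have hnpos : (0 : ℝ) < n := by
    exact_mod_cast (show 0 < n by omega)
  have hreal : (n : ℝ) * d ≤ 4 * exN n (⊤ : SimpleGraph (Fin 2)) F := by
    exact_mod_cast hle.trans (Nat.mul_le_mul_left 4 hex)
  have hexpos : (0 : ℝ) < exN n (⊤ : SimpleGraph (Fin 2)) F := by
    have := mul_pos hnpos hdpos
    linarith
  rw [dist_zero_right, Real.norm_of_nonneg (by positivity), div_lt_iff₀ hexpos]
  rw [div_lt_iff₀ hε] at hd
  nlinarith [mul_lt_mul_of_pos_left hd hnpos]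

/-- If `F` is not a forest, then `ex(n, M_k, F) = (1 + o(1)) · ex(n,F)^k / k!`. -/
theorem stmt7 {W : Type*} [Fintype W] (F : SimpleGraph W) (hF : ¬ F.IsAcyclic)
    (k : ℕ) (hk : 1 ≤ k) :
    Tendsto (fun n : ℕ =>
        (exN n (matchingGraph k) F * k.factorial : ℝ) /
          (exN n (⊤ : SimpleGraph (Fin 2)) F : ℝ) ^ k)
      atTop (nhds 1) := by
  have hbot : F ≠ ⊥ := by
    rintro rfl
    exact hF isAcyclic_bot
  have hlim := tendsto_div_exN_top hF
  have hpos : ∀ᶠ n : ℕ in atTop, 0 < exN n (⊤ : SimpleGraph (Fin 2)) F := by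
    obtain ⟨m, hm⟩ := exists_hasCycleOfLength_of_not_isAcyclic hF
    filter_upwards [eventually_ge_atTop (2 * (1 ^ (m + 2) + 1 + 1))] with n hn
    obtain ⟨G, _, hcyc, hle⟩ := exists_not_hasCycleOfLength_mul_le_card_edgeFinset m 1 n hn
    have hex := copyCount_le_exN (⊤ : SimpleGraph (Fin 2))
      (show GFree F G from fun ⟨f, hf⟩ => hcyc (hm.map f hf))
    rw [copyCount_top_fin_two] at hex
    rw [one_pow] at hn
    omega
  have hlower : Tendsto
      (fun n : ℕ => (1 - 2 * k * ((n : ℝ) / exN n (⊤ : SimpleGraph (Fin 2)) F)) ^ k)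
      atTop (nhds 1) := by
    simpa using ((hlim.const_mul (2 * (k : ℝ))).const_sub 1).pow k
  have hsmall : ∀ᶠ n : ℕ in atTop,
      2 * k * ((n : ℝ) / exN n (⊤ : SimpleGraph (Fin 2)) F) < 1 := by
    have := hlim.const_mul (2 * (k : ℝ))
    rw [mul_zero] at this
    exact this.eventually_lt_const one_pos
  refine tendsto_of_tendsto_of_tendsto_of_le_of_le' hlower tendsto_const_nhds ?_ ?_
  · filter_upwards [hpos, hsmall] with n hn hs
    classical
    obtain ⟨G, hG, hcard⟩ := exists_copyCount_eq_exN n (⊤ : SimpleGraph (Fin 2)) hbot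
    have hle := copyCount_le_exN (matchingGraph k) hG
    rw [copyCount_top_fin_two] at hcard
    rw [copyCount_matchingGraph] at hle
    have hpow := (pow_le_card_matchings_mul_factorial G k).trans
      (Nat.mul_le_mul_right _ hle)
    rw [hcard, Fintype.card_fin] at hpow
    have hn' : (0 : ℝ) < exN n (⊤ : SimpleGraph (Fin 2)) F := by exact_mod_cast hn
    rw [← mul_div_assoc, div_lt_one hn'] at hs
    have hs' : 2 * k * n ≤ exN n (⊤ : SimpleGraph (Fin 2)) F := by exact_mod_cast hs.le
    have hpow' : ((exN n (⊤ : SimpleGraph (Fin 2)) F : ℝ) - 2 * k * n) ^ k ≤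
        exN n (matchingGraph k) F * k.factorial := by
      have := (Nat.cast_le (α := ℝ)).2 hpow
      push_cast [Nat.cast_sub hs'] at this
      exact this
    have hmul : (1 - 2 * k * ((n : ℝ) / exN n (⊤ : SimpleGraph (Fin 2)) F)) *
        exN n (⊤ : SimpleGraph (Fin 2)) F = exN n (⊤ : SimpleGraph (Fin 2)) F - 2 * k * n := by
      rw [sub_mul, one_mul, mul_assoc, div_mul_cancel₀ _ hn'.ne']
    rw [le_div_iff₀ (by positivity), ← mul_pow, hmul]
    exact hpow'
  · filter_upwards [hpos] with n hn
    classical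
    obtain ⟨G, hG, hcard⟩ := exists_copyCount_eq_exN n (matchingGraph k) hbot
    have hle := copyCount_le_exN (⊤ : SimpleGraph (Fin 2)) hG
    rw [copyCount_top_fin_two] at hle
    rw [copyCount_matchingGraph] at hcard
    have hpow := (card_matchings_mul_factorial_le G k).trans (Nat.pow_le_pow_left hle k)
    rw [hcard] at hpow
    have hn' : (0 : ℝ) < exN n (⊤ : SimpleGraph (Fin 2)) F := by exact_mod_cast hn
    rw [div_le_one (by positivity)]
    exact_mod_cast hpow
end
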